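/- arXiv:1208.0378 — 6 statements merged into one kernel-verified Lean document; each statement's English description precedes it below -/
import Mathlib

section
/- (Proposition 1) For every finite simple graph G with real edge weights θ, the chain of inequalities 0 ≥ CC_2*(θ) ≥ CC_4*(θ) ≥ (3/2)·CC_2*(θ) holds; in particular the cost of the optimal 4-colorable partition is bounded below by 3/2 times the cost of the optimal 2-colorable partition. -/
open Finset

/-- Cost of a labeling `L : V → S`: sum of weights `θ e` over edges `e` of `G`
whose two endpoints receive different labels. -/
noncomputable def cost {V : Type*} [Fintype V] [DecidableEq V]
    (G : SimpleGraph V) [DecidableRel G.Adj]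
    {S : Type*} [DecidableEq S] (θ : Sym2 V → ℝ) (L : V → S) : ℝ :=
  ∑ e ∈ G.edgeFinset, if (e.map L).IsDiag then 0 else θ e

/-- `CC G θ k` is the optimal correlation clustering cost over `k`-labelings. -/
noncomputable def CC {V : Type*} [Fintype V] [DecidableEq V]
    (G : SimpleGraph V) [DecidableRel G.Adj] (θ : Sym2 V → ℝ) (k : ℕ) : ℝ :=
  sInf (Set.range fun L : V → Fin k => cost G θ L)

/-- `CCstar G θ` is the optimal correlation clustering cost over all partitions
of `V`, realized as labelings `L : V → V`. -/
noncomputable def CCstar {V : Type*} [Fintype V] [DecidableEq V]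
    (G : SimpleGraph V) [DecidableRel G.Adj] (θ : Sym2 V → ℝ) : ℝ :=
  sInf (Set.range fun L : V → V => cost G θ L)

lemma CC_le_cost {V : Type*} [Fintype V] [DecidableEq V]
    (G : SimpleGraph V) [DecidableRel G.Adj] (θ : Sym2 V → ℝ) (k : ℕ) (L : V → Fin k) :
    CC G θ k ≤ cost G θ L :=
  csInf_le (Set.finite_range _).bddBelow ⟨L, rfl⟩

lemma split_cost {V : Type*} [Fintype V] [DecidableEq V]
    (G : SimpleGraph V) [DecidableRel G.Adj] (θ : Sym2 V → ℝ) (L : V → Fin 4) :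
    cost G θ (fun v => (![0, 0, 1, 1] : Fin 4 → Fin 2) (L v))
      + cost G θ (fun v => (![0, 1, 0, 1] : Fin 4 → Fin 2) (L v))
      + cost G θ (fun v => (![0, 1, 1, 0] : Fin 4 → Fin 2) (L v)) = 2 * cost G θ L := by
  unfold cost
  rw [← Finset.sum_add_distrib, ← Finset.sum_add_distrib, Finset.mul_sum]
  refine Finset.sum_congr rfl fun e _ => ?_
  induction e using Sym2.ind with
  | _ u v =>
    simp only [Sym2.map_mk, Sym2.mk_isDiag_iff]
    generalize L u = a
    generalize L v = b
    fin_cases a <;> fin_cases b <;> simp <;> ring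

/-- Proposition 1: `0 ≥ CC_2*(θ) ≥ CC_4*(θ) ≥ (3/2)·CC_2*(θ)`. -/
theorem cc_two_four_bounds {V : Type*} [Fintype V] [DecidableEq V]
    (G : SimpleGraph V) [DecidableRel G.Adj] (θ : Sym2 V → ℝ) :
    CC G θ 2 ≤ 0 ∧ CC G θ 4 ≤ CC G θ 2 ∧ (3 / 2) * CC G θ 2 ≤ CC G θ 4 := by
  refine ⟨?_, ?_, ?_⟩
  · refine (CC_le_cost G θ 2 fun _ => 0).trans (le_of_eq ?_)
    unfold cost
    refine Finset.sum_eq_zero fun e _ => ?_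
    induction e using Sym2.ind with
    | _ u v => simp
  · refine le_csInf (Set.range_nonempty _) ?_
    rintro _ ⟨L, rfl⟩
    refine (CC_le_cost G θ 4 fun v => Fin.castLE (by norm_num) (L v)).trans (le_of_eq ?_)
    unfold cost
    refine Finset.sum_congr rfl fun e _ => ?_
    induction e using Sym2.ind with
    | _ u v => simp [Sym2.map_mk, Sym2.mk_isDiag_iff]
  · refine le_csInf (Set.range_nonempty _) ?_
    rintro _ ⟨L, rfl⟩
    have h := split_cost G θ L
    have h1 := CC_le_cost G θ 2 (fun v => (![0, 0, 1, 1] : Fin 4 → Fin 2) (L v))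
    have h2 := CC_le_cost G θ 2 (fun v => (![0, 1, 0, 1] : Fin 4 → Fin 2) (L v))
    have h3 := CC_le_cost G θ 2 (fun v => (![0, 1, 1, 0] : Fin 4 → Fin 2) (L v))
    show _ ≤ cost G θ L
    linarith
end

section
/- (Corollary) For every finite simple graph G with real edge weights θ, if the optimal 2-colorable correlation clustering cost is zero, CC_2*(θ) = 0, then the optimal 4-colorable correlation clustering cost is also zero, CC_4*(θ) = 0. -/
open Finset

/-- Corollary: if `CC_2*(θ) = 0` then `CC_4*(θ) = 0`. -/
theorem cc_four_eq_zero_of_cc_two_eq_zero {V : Type*} [Fintype V] [DecidableEq V]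
    (G : SimpleGraph V) [DecidableRel G.Adj] (θ : Sym2 V → ℝ)
    (h : CC G θ 2 = 0) : CC G θ 4 = 0 := by
  have hbdd : ∀ k : ℕ, BddBelow (Set.range fun L : V → Fin k => cost G θ L) :=
    fun k => (Set.finite_range _).bddBelow
  have h2 : ∀ L : V → Fin 2, 0 ≤ cost G θ L := fun L => by
    rw [← h]
    exact csInf_le (hbdd 2) ⟨L, rfl⟩
  have h4 : ∀ L : V → Fin 4, 0 ≤ cost G θ L := fun L => by
    have key : ∑ i : Fin 4, cost G θ (fun v => if L v = i then (0 : Fin 2) else 1)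
        = 2 * cost G θ L := by
      unfold cost
      rw [Finset.sum_comm, Finset.mul_sum]
      refine Finset.sum_congr rfl fun e _ => ?_
      induction e using Sym2.ind with
      | _ x y =>
        simp only [Sym2.map_mk, Sym2.mk_isDiag_iff]
        generalize L x = a
        generalize L y = b
        generalize θ s(x, y) = t
        fin_cases a <;> fin_cases b <;> simp [Fin.sum_univ_four] <;> ring
    have : 0 ≤ ∑ i : Fin 4, cost G θ (fun v => if L v = i then (0 : Fin 2) else 1) :=
      Finset.sum_nonneg fun i _ => h2 _
    linarith
  have h0 : cost G θ (fun _ : V => (0 : Fin 4)) = 0 := by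
    unfold cost
    refine Finset.sum_eq_zero fun e _ => ?_
    induction e using Sym2.ind with
    | _ x y => simp
  apply le_antisymm
  · rw [← h0]
    exact csInf_le (hbdd 4) ⟨_, rfl⟩
  · apply le_csInf (Set.range_nonempty _)
    rintro _ ⟨L, rfl⟩
    exact h4 L
end

section
/- For every finite simple graph G with real edge weights λ, the optimal correlation clustering cost over all partitions is zero if and only if the optimal 2-colorable clustering cost is zero: CC*(λ) = 0 ⟺ CC_2*(λ) = 0. -/
open Finset

lemma sInf_range_eq_zero_iff_aux {ι : Type*} [Finite ι] (f : ι → ℝ) (i0 : ι) (h0 : f i0 = 0) :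
    sInf (Set.range f) = 0 ↔ ∀ i, 0 ≤ f i := by
  have hb : BddBelow (Set.range f) := (Set.finite_range f).bddBelow
  constructor
  · intro h i
    rw [← h]
    exact csInf_le hb ⟨i, rfl⟩
  · intro h
    apply le_antisymm
    · rw [← h0]
      exact csInf_le hb ⟨i0, rfl⟩
    · refine le_csInf ⟨_, i0, rfl⟩ ?_
      rintro _ ⟨i, rfl⟩
      exact h i

lemma cost_const_aux {V : Type*} [Fintype V] [DecidableEq V]
    (G : SimpleGraph V) [DecidableRel G.Adj] {S : Type*} [DecidableEq S]
    (θ : Sym2 V → ℝ) (L : V → S) (h : ∀ u v, L u = L v) : cost G θ L = 0 := by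
  unfold cost
  refine Finset.sum_eq_zero ?_
  intro e _
  induction e with
  | _ u v => simp [h u v]

lemma cost_congr_aux {V : Type*} [Fintype V] [DecidableEq V]
    (G : SimpleGraph V) [DecidableRel G.Adj] {S T : Type*} [DecidableEq S] [DecidableEq T]
    (θ : Sym2 V → ℝ) (L : V → S) (M : V → T) (h : ∀ u v, L u = L v ↔ M u = M v) :
    cost G θ L = cost G θ M := by
  unfold cost
  refine Finset.sum_congr rfl ?_
  intro e _
  induction e with
  | _ u v => simp [h u v]

lemma cost_sum_aux {V : Type*} [Fintype V] [DecidableEq V]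
    (G : SimpleGraph V) [DecidableRel G.Adj]
    (θ : Sym2 V → ℝ) (L : V → V) :
    ∑ a : V, cost G θ (fun v => if L v = a then (0 : Fin 2) else 1) = 2 * cost G θ L := by
  unfold cost
  rw [Finset.sum_comm, Finset.mul_sum]
  refine Finset.sum_congr rfl ?_
  intro e _
  induction e with
  | _ u v =>
    by_cases h : L u = L v
    · simp [h]
    · have : ∀ a : V, (if ((s(u, v)).map
          (fun v => if L v = a then (0 : Fin 2) else 1)).IsDiag then 0 else θ s(u, v))
          = (if L u = a then θ s(u, v) else 0) + (if L v = a then θ s(u, v) else 0) := by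
        intro a
        by_cases h1 : L u = a <;> by_cases h2 : L v = a
        · exact absurd (h1.trans h2.symm) h
        all_goals simp [h1, h2]
      rw [Finset.sum_congr rfl (fun a _ => this a), Finset.sum_add_distrib]
      simp [h]
      ring

/-- the optimal correlation clustering cost over all partitions is
zero iff the optimal 2-colorable clustering cost is zero. -/
theorem ccstar_eq_zero_iff_cc_two_eq_zero {V : Type*} [Fintype V] [DecidableEq V]
    (G : SimpleGraph V) [DecidableRel G.Adj] (lam : Sym2 V → ℝ) :
    CCstar G lam = 0 ↔ CC G lam 2 = 0 := by
  have hc : ∃ L : V → V, ∀ u v, L u = L v := by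
    rcases isEmpty_or_nonempty V with h | ⟨⟨a⟩⟩
    · exact ⟨id, fun u => isEmptyElim u⟩
    · exact ⟨fun _ => a, fun _ _ => rfl⟩
  obtain ⟨L0, hL0⟩ := hc
  unfold CCstar CC
  rw [sInf_range_eq_zero_iff_aux _ L0 (cost_const_aux G lam L0 hL0),
    sInf_range_eq_zero_iff_aux _ (fun _ : V => (0 : Fin 2))
      (cost_const_aux G lam _ (fun _ _ => rfl))]
  constructor
  · intro h M
    rcases isEmpty_or_nonempty V with hV | hV
    · exact (cost_const_aux G lam M (fun u => isEmptyElim u)).ge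
    · have key : ∀ v, M (Function.invFun M (M v)) = M v :=
        fun v => Function.invFun_eq ⟨v, rfl⟩
      have := h (fun v => Function.invFun M (M v))
      rwa [cost_congr_aux G lam _ M] at this
      intro u v
      constructor
      · intro e
        rw [← key u, ← key v]
        exact congrArg M e
      · intro e
        simp only [e]
  · intro h L
    have h1 := cost_sum_aux G lam L
    have h2 : 0 ≤ ∑ a : V, cost G lam (fun v => if L v = a then (0 : Fin 2) else 1) :=
      Finset.sum_nonneg (fun a _ => h _)
    linarith
end

section
/- For every finite simple graph G with real edge weights θ and every integer m ≥ 1, the optimal correlation clustering costs satisfy CC_{2m}*(θ) ≥ ((2m−1)/m)·CC_2*(θ); this generalizes the Proposition 1 bound (the case m = 2 giving the factor 3/2) by averaging the costs of the 2-labelings obtained from all balanced merges of 2m labels into two groups of size m. -/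
open Finset

def ccColor (m : ℕ) (a : Fin (2 * m)) : Fin 2 := if a.val < m then 0 else 1

lemma ccColor_card (m : ℕ) (c : Fin 2) :
    (∑ b : Fin (2 * m), if ccColor m b = c then (0 : ℝ) else 1) = m := by
  have key : ∀ c : Fin 2, (∑ b : Fin (2 * m), if ccColor m b = c then (0 : ℝ) else 1)
      = ∑ b ∈ Finset.range (2 * m), if (if b < m then (0 : Fin 2) else 1) = c then (0 : ℝ) else 1 := by
    intro c
    rw [← Fin.sum_univ_eq_sum_range
      (fun b => if (if b < m then (0 : Fin 2) else 1) = c then (0 : ℝ) else 1)]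
    rfl
  rw [key, two_mul, Finset.sum_range_add]
  have h1 : ∀ b ∈ Finset.range m, (if (if b < m then (0 : Fin 2) else 1) = c then (0 : ℝ) else 1)
      = if (0 : Fin 2) = c then 0 else 1 := by
    intro b hb
    rw [if_pos (Finset.mem_range.1 hb)]
  have h2 : ∀ b ∈ Finset.range m,
      (if (if m + b < m then (0 : Fin 2) else 1) = c then (0 : ℝ) else 1)
      = if (1 : Fin 2) = c then 0 else 1 := by
    intro b hb
    rw [if_neg (by omega : ¬ m + b < m)]
  rw [Finset.sum_congr rfl h1, Finset.sum_congr rfl h2]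
  fin_cases c <;> simp

noncomputable def ccP (m : ℕ) (a b : Fin (2 * m)) : ℝ :=
  ∑ σ : Equiv.Perm (Fin (2 * m)), if ccColor m (σ b) = ccColor m (σ a) then (0 : ℝ) else 1

lemma ccP_swap (m : ℕ) (a b b' : Fin (2 * m)) (h : b ≠ a) (h' : b' ≠ a) :
    ccP m a b' = ccP m a b := by
  unfold ccP
  refine Fintype.sum_equiv (Equiv.mulRight (Equiv.swap b b')) _ _ ?_
  intro σ
  simp [Equiv.Perm.mul_apply, Equiv.swap_apply_of_ne_of_ne h.symm h'.symm]

lemma ccP_self (m : ℕ) (a : Fin (2 * m)) : ccP m a a = 0 := by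
  simp [ccP]

lemma ccP_val (m : ℕ) (a b : Fin (2 * m)) (h : b ≠ a) :
    (2 * (m : ℝ) - 1) * ccP m a b = Fintype.card (Equiv.Perm (Fin (2 * m))) * m := by
  have h1 : ∑ b', ccP m a b' = Fintype.card (Equiv.Perm (Fin (2 * m))) * m := by
    unfold ccP
    rw [Finset.sum_comm]
    have : ∀ σ : Equiv.Perm (Fin (2 * m)),
        (∑ b', if ccColor m (σ b') = ccColor m (σ a) then (0 : ℝ) else 1) = m := by
      intro σ
      rw [Equiv.sum_comp σ (fun b' => if ccColor m b' = ccColor m (σ a) then (0 : ℝ) else 1)]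
      exact ccColor_card m _
    simp only [this]
    simp
  have h2 : ∀ b', ccP m a b' = ccP m a b - if b' = a then ccP m a b else 0 := by
    intro b'
    by_cases hb : b' = a
    · subst hb; simp [ccP_self]
    · simp [hb, ccP_swap m a b b' h hb]
  rw [← h1, Finset.sum_congr rfl (fun b' _ => h2 b'), Finset.sum_sub_distrib]
  simp
  ring

lemma cc_two_le {V : Type*} [Fintype V] [DecidableEq V]
    (G : SimpleGraph V) [DecidableRel G.Adj] (θ : Sym2 V → ℝ) (L : V → Fin 2) :
    CC G θ 2 ≤ cost G θ L :=
  csInf_le (Set.finite_range _).bddBelow ⟨L, rfl⟩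

lemma cc_sum {V : Type*} [Fintype V] [DecidableEq V]
    (G : SimpleGraph V) [DecidableRel G.Adj] (θ : Sym2 V → ℝ) (m : ℕ)
    (L : V → Fin (2 * m)) :
    (2 * (m : ℝ) - 1) * ∑ σ : Equiv.Perm (Fin (2 * m)), cost G θ (fun v => ccColor m (σ (L v)))
      = Fintype.card (Equiv.Perm (Fin (2 * m))) * m * cost G θ L := by
  unfold cost
  rw [Finset.sum_comm, Finset.mul_sum, Finset.mul_sum]
  refine Finset.sum_congr rfl ?_
  intro e _
  induction e using Sym2.ind with
  | _ x y =>
    simp only [Sym2.map_mk, Sym2.mk_isDiag_iff]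
    have : (∑ σ : Equiv.Perm (Fin (2 * m)),
        if ccColor m (σ (L x)) = ccColor m (σ (L y)) then 0 else θ s(x, y))
        = ccP m (L y) (L x) * θ s(x, y) := by
      unfold ccP
      rw [Finset.sum_mul]
      refine Finset.sum_congr rfl fun σ _ => ?_
      split_ifs <;> simp
    rw [this, ← mul_assoc]
    by_cases h : L x = L y
    · simp [h, ccP_self]
    · rw [ccP_val m _ _ h, if_neg h]

/-- for every `m ≥ 1`, `CC_{2m}*(θ) ≥ ((2m−1)/m)·CC_2*(θ)`,
generalizing Proposition 1 (the case `m = 2` giving the factor `3/2`). -/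
theorem cc_two_m_lower_bound {V : Type*} [Fintype V] [DecidableEq V]
    (G : SimpleGraph V) [DecidableRel G.Adj] (θ : Sym2 V → ℝ)
    (m : ℕ) (hm : 1 ≤ m) :
    ((2 * (m : ℝ) - 1) / (m : ℝ)) * CC G θ 2 ≤ CC G θ (2 * m) := by
  have hm' : (1 : ℝ) ≤ m := by exact_mod_cast hm
  haveI : Nonempty (Fin (2 * m)) := ⟨⟨0, by omega⟩⟩
  refine le_csInf (Set.range_nonempty _) ?_
  rintro _ ⟨L, rfl⟩
  have h1 : (Fintype.card (Equiv.Perm (Fin (2 * m))) : ℝ) * CC G θ 2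
      ≤ ∑ σ : Equiv.Perm (Fin (2 * m)), cost G θ (fun v => ccColor m (σ (L v))) := by
    have := Finset.card_nsmul_le_sum (Finset.univ : Finset (Equiv.Perm (Fin (2 * m))))
      (fun σ => cost G θ (fun v => ccColor m (σ (L v)))) (CC G θ 2)
      (fun σ _ => cc_two_le G θ _)
    rwa [nsmul_eq_mul, Finset.card_univ] at this
  have h2 := cc_sum G θ m L
  have hN : (0 : ℝ) < Fintype.card (Equiv.Perm (Fin (2 * m))) := by
    exact_mod_cast Fintype.card_pos
  have h3 := mul_le_mul_of_nonneg_left h1 (by linarith : (0 : ℝ) ≤ 2 * (m : ℝ) - 1)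
  rw [h2] at h3
  rw [div_mul_eq_mul_div, div_le_iff₀ (by linarith)]
  refine le_of_mul_le_mul_left ?_ hN
  simp only
  linarith
end

section
/- (PlanarCC lower bound, equation (9)) For every finite simple graph G with real edge weights θ and every λ : E → ℝ such that the optimal 2-colorable clustering cost of λ is zero (CC_2*(λ) = 0), the optimal correlation clustering cost satisfies CC*(θ) ≥ Σ_{e∈E} min(θ_e − λ_e, 0). -/
open Finset

theorem sum_two_cost {V : Type*} [Fintype V] [DecidableEq V]
    (G : SimpleGraph V) [DecidableRel G.Adj] (lam : Sym2 V → ℝ) (L : V → V) :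
    ∑ x : V, cost G lam (fun v => if L v = x then (0 : Fin 2) else 1) = 2 * cost G lam L := by
  unfold cost
  rw [Finset.sum_comm, Finset.mul_sum]
  refine Finset.sum_congr rfl fun e _ => ?_
  induction e using Sym2.ind with
  | _ u v =>
    simp only [Sym2.map_mk, Sym2.mk_isDiag_iff]
    by_cases huv : L u = L v
    · simp [huv]
    · have h1 : ∀ x : V, (if (if L u = x then (0 : Fin 2) else 1) = (if L v = x then (0 : Fin 2) else 1)
          then (0 : ℝ) else lam s(u, v))
          = (if L u = x then lam s(u, v) else 0) + (if L v = x then lam s(u, v) else 0) := by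
        intro x
        by_cases h1 : L u = x <;> by_cases h2 : L v = x
        · exact absurd (h1.trans h2.symm) huv
        · simp [h1, h2]
        · simp [h1, h2]
        · simp [h1, h2]
      rw [Finset.sum_congr rfl fun x _ => h1 x, Finset.sum_add_distrib]
      simp [huv]
      ring

/-- PlanarCC lower bound: if `CC_2*(λ) = 0` then
`CC*(θ) ≥ Σ_e min(θ_e − λ_e, 0)`. -/
theorem planarcc_lower_bound {V : Type*} [Fintype V] [DecidableEq V]
    (G : SimpleGraph V) [DecidableRel G.Adj] (θ lam : Sym2 V → ℝ)
    (h : CC G lam 2 = 0) :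
    ∑ e ∈ G.edgeFinset, min (θ e - lam e) 0 ≤ CCstar G θ := by
  have h2 : ∀ M : V → Fin 2, 0 ≤ cost G lam M := fun M => by
    rw [← h]
    exact csInf_le (Set.finite_range _).bddBelow ⟨M, rfl⟩
  refine le_csInf ⟨_, id, rfl⟩ ?_
  rintro _ ⟨L, rfl⟩
  have h3 : 0 ≤ cost G lam L := by
    have := sum_two_cost G lam L
    have h4 := Finset.sum_nonneg fun (x : V) (_ : x ∈ Finset.univ) =>
      h2 (fun v => if L v = x then (0 : Fin 2) else 1)
    linarith
  have h5 : ∑ e ∈ G.edgeFinset, min (θ e - lam e) 0 + cost G lam L ≤ cost G θ L := by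
    unfold cost
    rw [← Finset.sum_add_distrib]
    refine Finset.sum_le_sum fun e _ => ?_
    split_ifs
    · simp
    · linarith [min_le_left (θ e - lam e) 0]
  show _ ≤ cost G θ L
  linarith
end

section
/- (Appendix A, dual of the bound LP) For every finite simple graph G with real edge weights θ, the optimal value of the linear program maximizing Σ_{e∈E} (θ_e − λ_e) over λ : E → ℝ subject to θ_e ≤ λ_e ≤ max(0, θ_e) for all e and Σ_e λ_e X_e ≥ 0 for every cut indicator X, equals the optimal value of the program minimizing Σ_{e∈E} [θ_e z_e − min(θ_e, 0)·max(z_e − 1, 0)] over z in the cut cone. -/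
open Finset

/-- Indicator vector of the cut determined by the vertex subset `S`:
`1` on pairs crossing `S`, `0` otherwise. -/
noncomputable def cutInd {V : Type*} [DecidableEq V] (S : Finset V) : Sym2 V → ℝ :=
  fun e => if (e.map fun v => decide (v ∈ S)).IsDiag then 0 else 1

/-- The cut cone: all nonnegative real combinations of cut indicator vectors. -/
def cutCone (V : Type*) [DecidableEq V] : Set (Sym2 V → ℝ) :=
  {z | ∃ (n : ℕ) (S : Fin n → Finset V) (α : Fin n → ℝ),
    (∀ i, 0 ≤ α i) ∧ z = fun e => ∑ i, α i * cutInd (S i) e}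


lemma cutCone_of_weights {V : Type*} [Fintype V] [DecidableEq V] (a : Finset V → ℝ)
    (ha : ∀ S, 0 ≤ a S) : (fun e => ∑ S, a S * cutInd S e) ∈ cutCone V := by
  refine ⟨Fintype.card (Finset V), fun i => (Fintype.equivFin (Finset V)).symm i,
    fun i => a ((Fintype.equivFin (Finset V)).symm i), fun i => ha _, ?_⟩
  funext e
  exact (Equiv.sum_comp (Fintype.equivFin (Finset V)).symm (fun S => a S * cutInd S e)).symm

lemma edge_weak (t l z : ℝ) (h1 : t ≤ l) (h2 : l ≤ max 0 t) (hz : 0 ≤ z) :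
    t - l + l * z ≤ t * z - min t 0 * max (z - 1) 0 := by
  rcases le_total 0 t with h | h
  · rw [max_eq_right h] at h2
    have : l = t := le_antisymm h2 h1
    subst this
    rw [min_eq_right h]; linarith
  · rw [max_eq_left h] at h2
    rw [min_eq_left h]
    rcases le_total 1 z with h' | h'
    · rw [max_eq_left (by linarith)]; nlinarith
    · rw [max_eq_right (by linarith)]; nlinarith

lemma edge_attain (t z : ℝ) : ∃ l, t ≤ l ∧ l ≤ max 0 t ∧
    t - l + l * z = t * z - min t 0 * max (z - 1) 0 := by
  rcases le_total 0 t with h | h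
  · exact ⟨t, le_rfl, le_max_right _ _, by rw [min_eq_right h]; ring⟩
  · rcases le_total 1 z with h' | h'
    · exact ⟨0, h, le_max_left _ _, by
        rw [min_eq_left h, max_eq_left (by linarith)]; ring⟩
    · exact ⟨t, le_rfl, le_max_right _ _, by
        rw [min_eq_left h, max_eq_right (by linarith)]; ring⟩

lemma cutInd_nonneg' {V : Type*} [DecidableEq V] (S : Finset V) (e : Sym2 V) :
    0 ≤ cutInd S e := by
  unfold cutInd; split_ifs <;> norm_num

lemma weak_dual {V : Type*} [DecidableEq V]
    (F : Finset (Sym2 V)) (θ lam z : Sym2 V → ℝ)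
    (h1 : ∀ e ∈ F, θ e ≤ lam e ∧ lam e ≤ max 0 (θ e))
    (h2 : ∀ S : Finset V, 0 ≤ ∑ e ∈ F, lam e * cutInd S e) (hz : z ∈ cutCone V) :
    ∑ e ∈ F, (θ e - lam e) ≤ ∑ e ∈ F, (θ e * z e - min (θ e) 0 * max (z e - 1) 0) := by
  obtain ⟨n, S, a, ha, rfl⟩ := hz
  set z : Sym2 V → ℝ := fun e => ∑ i, a i * cutInd (S i) e with hzdef
  have hz0 : ∀ e, 0 ≤ z e := fun e =>
    Finset.sum_nonneg fun i _ => mul_nonneg (ha i) (cutInd_nonneg' _ _)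
  have h3 : 0 ≤ ∑ e ∈ F, lam e * z e := by
    have : ∑ e ∈ F, lam e * z e = ∑ i, a i * ∑ e ∈ F, lam e * cutInd (S i) e := by
      simp only [hzdef, Finset.mul_sum]
      rw [Finset.sum_comm]
      refine Finset.sum_congr rfl fun i _ => Finset.sum_congr rfl fun e _ => by ring
    rw [this]
    exact Finset.sum_nonneg fun i _ => mul_nonneg (ha i) (h2 _)
  have h4 : ∑ e ∈ F, (θ e - lam e + lam e * z e) ≤
      ∑ e ∈ F, (θ e * z e - min (θ e) 0 * max (z e - 1) 0) :=
    Finset.sum_le_sum fun e he => edge_weak _ _ _ (h1 e he).1 (h1 e he).2 (hz0 e)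
  rw [Finset.sum_add_distrib] at h4
  linarith

lemma strong_dual {V : Type*} [Fintype V] [DecidableEq V]
    (F : Finset (Sym2 V)) (θ : Sym2 V → ℝ) (v : ℝ)
    (hv : ∀ lam : Sym2 V → ℝ, (∀ e, θ e ≤ lam e ∧ lam e ≤ max 0 (θ e)) →
      (∀ S : Finset V, 0 ≤ ∑ e ∈ F, lam e * cutInd S e) → ∑ e ∈ F, (θ e - lam e) < v) :
    ∃ z ∈ cutCone V, ∑ e ∈ F, (θ e * z e - min (θ e) 0 * max (z e - 1) 0) ≤ v := by
  let φ : (Sym2 V → ℝ) →ₗ[ℝ] ((Finset V → ℝ) × ℝ) :=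
    { toFun := fun lam => (fun S => ∑ e ∈ F, lam e * cutInd S e, - ∑ e ∈ F, lam e)
      map_add' := by
        intro x y
        ext <;> simp [add_mul, Finset.sum_add_distrib]; ring
      map_smul' := by
        intro c x
        ext <;> simp [Finset.mul_sum, mul_assoc] }
  have hφ : ∀ lam, φ lam = (fun S => ∑ e ∈ F, lam e * cutInd S e, - ∑ e ∈ F, lam e) :=
    fun _ => rfl
  have hφc : Continuous φ := φ.continuous_of_finiteDimensional
  let K : Set (Sym2 V → ℝ) := Set.Icc θ (fun e => max 0 (θ e))
  have hK : ∀ lam, lam ∈ K ↔ ∀ e, θ e ≤ lam e ∧ lam e ≤ max 0 (θ e) := by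
    intro lam
    simp only [K, Set.mem_Icc, Pi.le_def]
    exact ⟨fun h e => ⟨h.1 e, h.2 e⟩, fun h => ⟨fun e => (h e).1, fun e => (h e).2⟩⟩
  set w := v - ∑ e ∈ F, θ e with hw
  let B : Set ((Finset V → ℝ) × ℝ) := Set.Ici ((0 : Finset V → ℝ), w)
  have hB : ∀ p x, (p, x) ∈ B ↔ (∀ S, 0 ≤ p S) ∧ w ≤ x := by
    intro p x
    simp [B, Prod.le_def, Pi.le_def]
  have hdisj : Disjoint (φ '' K) B := by
    rw [Set.disjoint_left]
    rintro _ ⟨lam, hl, rfl⟩ hb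
    rw [hφ, hB] at hb
    have := hv lam ((hK lam).1 hl) hb.1
    rw [Finset.sum_sub_distrib] at this
    linarith [hb.2]
  have hKc : IsCompact K := isCompact_Icc
  obtain ⟨f, u, u', hfA, huu, hfB⟩ := geometric_hahn_banach_compact_closed
    ((convex_Icc (𝕜 := ℝ) θ (fun e => max 0 (θ e))).linear_image φ) (hKc.image hφc)
    (convex_Ici (𝕜 := ℝ) ((0 : Finset V → ℝ), w)) isClosed_Ici hdisj
  set a : Finset V → ℝ := fun S => f (Pi.single S 1, 0) with ha
  set b : ℝ := f (0, 1) with hb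
  have hf : ∀ p x, f (p, x) = ∑ S, p S * a S + x * b := by
    intro p x
    have h1 : (p, x) = (p, (0:ℝ)) + x • ((0 : Finset V → ℝ), (1:ℝ)) := by ext <;> simp
    have h2 : f (p, 0) = ∑ S, p S * a S := by
      have := LinearMap.pi_apply_eq_sum_univ (f.toLinearMap ∘ₗ LinearMap.inl ℝ (Finset V → ℝ) ℝ) p
      simp only [LinearMap.comp_apply, LinearMap.inl_apply, smul_eq_mul] at this
      refine this.trans (Finset.sum_congr rfl fun S _ => ?_)
      simp only [ha]
      have h3 : (fun j => if S = j then (1:ℝ) else 0) = Pi.single S 1 := by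
        ext T
        simp [Pi.single_apply, eq_comm]
      rw [h3]
      rfl
    rw [h1, map_add, map_smul, h2, smul_eq_mul]
  have ha0 : ∀ S, 0 ≤ a S := by
    intro S
    by_contra! h
    -- go far in direction S
    set t : ℝ := (|u' - w * b|) / (- a S) with ht
    have ht0 : 0 ≤ t := div_nonneg (abs_nonneg _) (by linarith)
    have hm : (Pi.single S t, w) ∈ B := by
      rw [hB]
      refine ⟨fun T => ?_, le_rfl⟩
      by_cases hT : T = S
      · subst hT; simpa using ht0
      · simp [hT]
    have h5 := hfB _ hm
    rw [hf] at h5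
    have h6 : ∑ T, (Pi.single S t : Finset V → ℝ) T * a T = t * a S := by
      simp [Pi.single_apply]
    rw [h6] at h5
    have h7 : t * a S = - |u' - w * b| := by
      have hne : a S ≠ 0 := h.ne
      rw [ht, div_neg, neg_mul, div_mul_cancel₀ _ hne]
    have h8 := neg_abs_le (u' - w * b)
    have h9 := le_abs_self (u' - w * b)
    linarith [abs_nonneg (u' - w * b)]
  have hl0 : (fun e => max 0 (θ e)) ∈ K := (hK _).2 fun e => ⟨le_max_right _ _, le_rfl⟩
  have hp0 : ∀ S : Finset V, 0 ≤ ∑ e ∈ F, max 0 (θ e) * cutInd S e := fun S =>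
    Finset.sum_nonneg fun e _ => mul_nonneg (le_max_left _ _) (cutInd_nonneg' _ _)
  have hb0 : 0 < b := by
    have h1 := hfA _ ⟨_, hl0, rfl⟩
    have h2 := hfB (fun S => ∑ e ∈ F, max 0 (θ e) * cutInd S e, w) ((hB _ _).2 ⟨hp0, le_rfl⟩)
    rw [hφ, hf] at h1
    rw [hf] at h2
    have h3 := hv _ ((hK _).1 hl0) hp0
    rw [Finset.sum_sub_distrib] at h3
    by_contra! h
    nlinarith
  refine ⟨fun e => ∑ S, (a S / b) * cutInd S e,
    cutCone_of_weights _ fun S => div_nonneg (ha0 S) hb0.le, ?_⟩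
  set z : Sym2 V → ℝ := fun e => ∑ S, (a S / b) * cutInd S e with hz
  choose lam hl1 hl2 hl3 using fun e => edge_attain (θ e) (z e)
  have h1 := hfA _ ⟨lam, (hK _).2 fun e => ⟨hl1 e, hl2 e⟩, rfl⟩
  have h2 := hfB (0, w) ((hB _ _).2 ⟨fun _ => le_rfl, le_rfl⟩)
  rw [hφ, hf] at h1
  rw [hf] at h2
  simp only [Pi.zero_apply, zero_mul, Finset.sum_const_zero, zero_add] at h2
  have h3 : ∑ S, (∑ e ∈ F, lam e * cutInd S e) * a S = b * ∑ e ∈ F, lam e * z e := by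
    simp only [hz, Finset.mul_sum, Finset.sum_mul]
    rw [Finset.sum_comm]
    refine Finset.sum_congr rfl fun e _ => Finset.sum_congr rfl fun S _ => ?_
    field_simp
  rw [h3] at h1
  have h4 : b * (∑ e ∈ F, lam e * z e - ∑ e ∈ F, lam e) < b * w := by nlinarith
  have h5 := lt_of_mul_lt_mul_left h4 hb0.le
  rw [← Finset.sum_congr rfl fun e _ => hl3 e, Finset.sum_add_distrib, Finset.sum_sub_distrib]
  linarith

/-- Appendix A, dual of the bound LP: the LP maximizing
`Σ_e (θ_e − λ_e)` subject to `θ_e ≤ λ_e ≤ max(0, θ_e)` and `Σ_e λ_e X_e ≥ 0`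
for every cut indicator `X` has the same optimal value as minimizing
`Σ_e [θ_e z_e − min(θ_e,0)·max(z_e − 1, 0)]` over `z` in the cut cone. -/
theorem lp_duality_bound {V : Type*} [Fintype V] [DecidableEq V]
    (G : SimpleGraph V) [DecidableRel G.Adj] (θ : Sym2 V → ℝ) :
    sSup {x : ℝ | ∃ lam : Sym2 V → ℝ,
        (∀ e ∈ G.edgeFinset, θ e ≤ lam e ∧ lam e ≤ max 0 (θ e)) ∧
        (∀ S : Finset V, 0 ≤ ∑ e ∈ G.edgeFinset, lam e * cutInd S e) ∧
        x = ∑ e ∈ G.edgeFinset, (θ e - lam e)} =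
      sInf {y : ℝ | ∃ z ∈ cutCone V,
        y = ∑ e ∈ G.edgeFinset,
          (θ e * z e - min (θ e) 0 * max (z e - 1) 0)} := by
  set P := {x : ℝ | ∃ lam : Sym2 V → ℝ,
        (∀ e ∈ G.edgeFinset, θ e ≤ lam e ∧ lam e ≤ max 0 (θ e)) ∧
        (∀ S : Finset V, 0 ≤ ∑ e ∈ G.edgeFinset, lam e * cutInd S e) ∧
        x = ∑ e ∈ G.edgeFinset, (θ e - lam e)} with hP
  set D := {y : ℝ | ∃ z ∈ cutCone V,
        y = ∑ e ∈ G.edgeFinset,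
          (θ e * z e - min (θ e) 0 * max (z e - 1) 0)} with hD
  have hPD : ∀ x ∈ P, ∀ y ∈ D, x ≤ y := by
    rintro x ⟨lam, h1, h2, rfl⟩ y ⟨z, hz, rfl⟩
    exact weak_dual _ θ lam z h1 h2 hz
  have hPn : P.Nonempty := ⟨_, fun e => max 0 (θ e), fun e _ => ⟨le_max_right _ _, le_rfl⟩,
    fun S => Finset.sum_nonneg fun e _ => mul_nonneg (le_max_left _ _) (cutInd_nonneg' _ _), rfl⟩
  have hDn : D.Nonempty := ⟨_, _, cutCone_of_weights (fun _ => 0) (fun _ => le_rfl), rfl⟩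
  obtain ⟨x0, hx0⟩ := id hPn
  obtain ⟨y0, hy0⟩ := id hDn
  have hPb : BddAbove P := ⟨y0, fun x hx => hPD x hx y0 hy0⟩
  have hDb : BddBelow D := ⟨x0, fun y hy => hPD x0 hx0 y hy⟩
  apply le_antisymm
  · exact csSup_le hPn fun x hx => le_csInf hDn fun y hy => hPD x hx y hy
  · refine le_of_forall_gt_imp_ge_of_dense fun v hv => ?_
    obtain ⟨z, hz, hzv⟩ := strong_dual G.edgeFinset θ v fun lam h1 h2 =>
      lt_of_le_of_lt (le_csSup hPb ⟨lam, fun e _ => h1 e, h2, rfl⟩) hv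
    exact (csInf_le hDb ⟨z, hz, rfl⟩).trans hzv
end
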